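/- For every countable MIF group G, the conjugacy action of G on L(G) is topologically transitive: for any nonempty open subsets U, V ⊆ L(G), there exists g ∈ G such that (g ∘ U) ∩ V ≠ ∅. -/

import Mathlib

open Set Function Pointwise

section Defs

variable {G : Type*} [Group G]

/-- A length function on a group. -/
def IsLengthFun (ℓ : G → ℕ) : Prop :=
  (∀ g : G, ℓ g = 0 ↔ g = 1) ∧ (∀ g : G, ℓ g⁻¹ = ℓ g) ∧ ∀ g h : G, ℓ (g * h) ≤ ℓ g + ℓ h

/-- The space of length functions, topologized as a subspace of `G → ℕ`. -/
abbrev LengthFun (G : Type*) [Group G] : Type _ := {ℓ : G → ℕ // IsLengthFun ℓ}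

/-- Word length with respect to a generating set `X`. -/
noncomputable def wordLength (X : Set G) (g : G) : ℕ :=
  sInf {n : ℕ | ∃ w : List G, w.length = n ∧ (∀ x ∈ w, x ∈ X ∨ x⁻¹ ∈ X) ∧ w.prod = g}

/-- A length function is a word length. -/
def IsWordLength (ℓ : G → ℕ) : Prop :=
  ∃ X : Set G, Subgroup.closure X = ⊤ ∧ ∀ g : G, ℓ g = wordLength X g

/-- Mixed identity free group. -/
def MIF (G : Type*) [Group G] : Prop :=
  ∀ w : Monoid.Coprod G (FreeGroup Unit), w ≠ 1 →
    ∃ g : G, Monoid.Coprod.lift (MonoidHom.id G) (FreeGroup.lift fun _ => g) w ≠ 1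

/-- The length function associated to a weight function `ω`. -/
noncomputable def weightLength (ω : G → ℕ) (g : G) : ℕ :=
  sInf {N : ℕ | ∃ w : List (G × Bool),
    (w.map fun p => ω p.1).sum = N ∧
    (w.map fun p => if p.2 then p.1 else p.1⁻¹).prod = g}

/-- `(ℓ, a)`-consistency of a tuple of distances. -/
def Consistent (ℓ : G → ℕ) {n : ℕ} (a : Fin n → G) (d : Fin n → ℕ) : Prop :=
  ∀ i j : Fin n, d i ≤ ℓ ((a i)⁻¹ * a j) + d j ∧ ℓ ((a i)⁻¹ * a j) ≤ d i + d j

/-- The bi-Lipschitz preorder on length functions. -/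
def Preceq (ℓ₁ ℓ₂ : G → ℕ) : Prop :=
  ∃ C : ℕ, ∀ g : G, g ≠ 1 → ℓ₁ g ≤ C * ℓ₂ g

/-- The conjugacy action of `G` on its space of length functions. -/
def conjLF (g : G) (ℓ : LengthFun G) : LengthFun G :=
  ⟨fun x => ℓ.1 (g⁻¹ * x * g), by
    obtain ⟨h1, h2, h3⟩ := ℓ.2
    refine ⟨fun x => ?_, fun x => ?_, fun x y => ?_⟩
    · rw [h1]
      constructor
      · intro h
        have := congrArg (fun z => g * z * g⁻¹) h
        simpa [mul_assoc] using this
      · rintro rfl; simp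
    · show ℓ.1 (g⁻¹ * x⁻¹ * g) = ℓ.1 (g⁻¹ * x * g)
      have h : g⁻¹ * x⁻¹ * g = (g⁻¹ * x * g)⁻¹ := by group
      rw [h, h2]
    · show ℓ.1 (g⁻¹ * (x * y) * g) ≤ ℓ.1 (g⁻¹ * x * g) + ℓ.1 (g⁻¹ * y * g)
      have h : g⁻¹ * (x * y) * g = (g⁻¹ * x * g) * (g⁻¹ * y * g) := by group
      rw [h]
      exact h3 _ _⟩

/-- Topological transitivity of the conjugacy action on `LengthFun G`. -/
def ConjTopTransitive (G : Type*) [Group G] : Prop :=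
  ∀ U V : Set (LengthFun G), IsOpen U → IsOpen V → U.Nonempty → V.Nonempty →
    ∃ g : G, ((conjLF g '' U) ∩ V).Nonempty

end Defs

/-- The language with one binary function symbol and countably many unary predicates. -/
def lengthLang : FirstOrder.Language where
  Functions := fun n => match n with | 2 => Unit | _ => Empty
  Relations := fun n => match n with | 1 => ℕ | _ => Empty

/-- The `lengthLang`-structure on `G` associated to a length function `ℓ`. -/
def lengthStructure {G : Type*} [Group G] (ℓ : G → ℕ) : lengthLang.Structure G where
  funMap {n} f x :=
    match n, f, x with
    | 2, _, x => x 0 * x 1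
  RelMap {n} r x :=
    match n, r, x with
    | 1, i, x => ℓ (x 0) = i

open scoped commutatorElement

namespace Monoid.CoprodI

variable {ι : Type*} {M : ι → Type*} [∀ i, Group (M i)]

open NeWord

/-- Every nontrivial element of a free product is given by a non-empty reduced word. -/
theorem exists_neWord_prod_eq {u : CoprodI M} (hu : u ≠ 1) :
    ∃ (k l : ι) (w : NeWord M k l), w.prod = u := by
  classical
  have hne : Word.equiv u ≠ Word.empty := fun h => hu <| by
    rw [← Word.equiv.symm_apply_apply u, h]
    rfl
  obtain ⟨k, l, w, hw⟩ := NeWord.of_word _ hne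
  exact ⟨k, l, w, by rw [NeWord.prod, hw]; exact Word.equiv.symm_apply_apply u⟩

theorem NeWord.prod_ne_one {k l : ι} (w : NeWord M k l) : w.prod ≠ 1 := by
  classical
  intro h
  have hw : w.toWord = Word.empty := Word.equiv.symm.injective (h.trans Word.prod_empty.symm)
  exact w.toList_ne_nil (congrArg Word.toList hw)

/-- Conjugating a reduced word by a letter of a factor which contains neither its first nor its
last letter. -/
theorem NeWord.exists_conj_of_ne {k l i : ι} (w : NeWord M k l) (hk : i ≠ k) (hl : l ≠ i)
    {a : M i} (ha : a ≠ 1) : ∃ w' : NeWord M i i, w'.prod = of a * w.prod * (of a)⁻¹ :=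
  ⟨append (append (singleton a ha) hk w) hl (singleton a⁻¹ (inv_ne_one.2 ha)), by simp⟩

/-- Conjugating a reduced word of which exactly the first letter lies in a given factor. -/
theorem NeWord.exists_conj_of_last_ne {i l : ι} (w : NeWord M i l) (hl : l ≠ i)
    (hM : ∀ y : M i, ∃ a : M i, a ≠ 1 ∧ a * y ≠ 1) :
    ∃ (a : M i) (w' : NeWord M i i), w'.prod = of a * w.prod * (of a)⁻¹ := by
  obtain ⟨a, ha, hay⟩ := hM w.head
  exact ⟨a, append (mulHead w a hay) hl (singleton a⁻¹ (inv_ne_one.2 ha)), by simp⟩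

/-- A nontrivial element of a free product has a conjugate whose reduced word starts and ends in
a given factor, provided that this factor has at least three elements. -/
theorem exists_conj_eq_neWord_prod {i : ι}
    (hM : ∀ y : M i, ∃ a : M i, a ≠ 1 ∧ a * y ≠ 1) {u : CoprodI M} (hu : u ≠ 1) :
    ∃ (t : CoprodI M) (w : NeWord M i i), w.prod = t * u * t⁻¹ := by
  obtain ⟨k, l, w, rfl⟩ := exists_neWord_prod_eq hu
  by_cases hk : k = i <;> by_cases hl : l = i
  · subst hk hl
    exact ⟨1, w, by simp⟩
  · subst hk
    obtain ⟨a, w', h⟩ := w.exists_conj_of_last_ne hl hM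
    exact ⟨of a, w', h⟩
  · subst hl
    obtain ⟨a, w', h⟩ := w.inv.exists_conj_of_last_ne hk hM
    exact ⟨of a, w'.inv, by simp [h, mul_assoc]⟩
  · obtain ⟨a, ha, -⟩ := hM 1
    obtain ⟨w', h⟩ := w.exists_conj_of_ne (Ne.symm hk) hl ha
    exact ⟨of a, w', h⟩

/-- Two nontrivial elements of a free product have conjugates which do not commute. -/
theorem exists_conj_commutator_ne_one {i j : ι} (hij : i ≠ j)
    (hM : ∀ y : M i, ∃ a : M i, a ≠ 1 ∧ a * y ≠ 1) [Nontrivial (M j)]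
    {u v : CoprodI M} (hu : u ≠ 1) (hv : v ≠ 1) :
    ∃ s t : CoprodI M, ⁅s * u * s⁻¹, t * v * t⁻¹⁆ ≠ 1 := by
  obtain ⟨s, w, hw⟩ := exists_conj_eq_neWord_prod hM hu
  obtain ⟨t, w₁, hw₁⟩ := exists_conj_eq_neWord_prod hM hv
  obtain ⟨b, hb⟩ := exists_ne (1 : M j)
  obtain ⟨w₂, hw₂⟩ := w₁.exists_conj_of_ne hij.symm hij hb
  refine ⟨s, of b * t, ?_⟩
  have h := NeWord.prod_ne_one (append (append (append w hij w₂) hij.symm w.inv) hij w₂.inv)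
  simpa [hw, hw₁, hw₂, commutatorElement_def, mul_assoc] using h

end Monoid.CoprodI

namespace Monoid.Coprod

/-- The two factors of a binary free product, as a family indexed by `Bool`. -/
def Factor (G H : Type) : Bool → Type
  | true => G
  | false => H

instance (G H : Type) [Group G] [Group H] : ∀ b, Group (Factor G H b)
  | true => inferInstanceAs (Group G)
  | false => inferInstanceAs (Group H)

variable {G H : Type} [Group G] [Group H]

/-- The inclusions of the factors into the binary free product. -/
def ofFactor (G H : Type) [Group G] [Group H] : ∀ b, Factor G H b →* Coprod G H
  | true => (inl : G →* Coprod G H)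
  | false => (inr : H →* Coprod G H)

/-- The canonical map from a binary free product to the indexed one. -/
def toCoprodI (G H : Type) [Group G] [Group H] : Coprod G H →* CoprodI (Factor G H) :=
  lift (CoprodI.of (M := Factor G H) (i := true)) (CoprodI.of (M := Factor G H) (i := false))

theorem toCoprodI_ofFactor (b : Bool) (x : Factor G H b) :
    toCoprodI G H (ofFactor G H b x) = CoprodI.of x := by
  cases b <;> rfl

/-- The binary free product as an indexed free product. -/
def mulEquivCoprodI : Coprod G H ≃* CoprodI (Factor G H) :=
  MonoidHom.toMulEquiv (toCoprodI G H) (CoprodI.lift (ofFactor G H))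
    (hom_ext
      (MonoidHom.ext fun x => CoprodI.lift_of (i := true) (ofFactor G H) x)
      (MonoidHom.ext fun x => CoprodI.lift_of (i := false) (ofFactor G H) x))
    (CoprodI.ext_hom _ _ fun b => MonoidHom.ext fun x =>
      (congrArg (toCoprodI G H) (CoprodI.lift_of (ofFactor G H) x)).trans
        (toCoprodI_ofFactor b x))

/-- Two nontrivial elements of a free product have conjugates which do not commute. -/
theorem exists_conj_commutator_ne_one [Nontrivial G]
    (hH : ∀ y : H, ∃ a : H, a ≠ 1 ∧ a * y ≠ 1) {u v : Coprod G H} (hu : u ≠ 1) (hv : v ≠ 1) :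
    ∃ s t : Coprod G H, ⁅s * u * s⁻¹, t * v * t⁻¹⁆ ≠ 1 := by
  have : Nontrivial (Factor G H true) := inferInstanceAs (Nontrivial G)
  let e : Coprod G H ≃* CoprodI (Factor G H) := mulEquivCoprodI
  obtain ⟨s, t, h⟩ := CoprodI.exists_conj_commutator_ne_one (M := Factor G H)
    (i := false) (j := true) (by simp) hH
    ((map_ne_one_iff e e.injective).2 hu) ((map_ne_one_iff e e.injective).2 hv)
  refine ⟨e.symm s, e.symm t, fun h' => h ?_⟩
  simpa [map_commutatorElement] using congrArg e h'

end Monoid.Coprod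

open Monoid

section MIF

variable {G : Type} [Group G]

/-- Evaluation of a word with constants in `G` at an element of `G`. -/
abbrev evalAt (g : G) : Coprod G (FreeGroup Unit) →* G :=
  Coprod.lift (MonoidHom.id G) (FreeGroup.lift fun _ => g)

/-- The variable of words with constants in `G`. -/
abbrev wordVar (G : Type) [Group G] : Coprod G (FreeGroup Unit) :=
  Coprod.inr (FreeGroup.of ())

theorem wordVar_ne_one : wordVar G ≠ 1 := fun h =>
  FreeGroup.of_ne_one () <| Coprod.inr_injective (h.trans (map_one _).symm)

theorem MIF.nontrivial (hG : MIF G) : Nontrivial G := by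
  obtain ⟨g, hg⟩ := hG _ wordVar_ne_one
  exact ⟨_, _, hg⟩

theorem FreeGroup.exists_ne_one_mul_ne_one {α : Type*} [Nonempty α] (y : FreeGroup α) :
    ∃ a : FreeGroup α, a ≠ 1 ∧ a * y ≠ 1 := by
  obtain ⟨a, ha⟩ := (Set.toFinite {1, y⁻¹}).exists_notMem
  simp only [mem_insert_iff, mem_singleton_iff, not_or] at ha
  exact ⟨a, ha.1, fun h => ha.2 (eq_inv_of_mul_eq_one_left h)⟩

/-- In an MIF group finitely many nontrivial words with constants are nontrivial at a common
element. -/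
theorem MIF.exists_forall_evalAt_ne_one (hG : MIF G) {S : Set (Coprod G (FreeGroup Unit))}
    (hS : S.Finite) (h1 : ∀ s ∈ S, s ≠ 1) : ∃ g : G, ∀ s ∈ S, evalAt g s ≠ 1 := by
  have := hG.nontrivial
  suffices ∃ w : Coprod G (FreeGroup Unit), w ≠ 1 ∧ ∀ g : G, evalAt g w ≠ 1 →
      ∀ s ∈ S, evalAt g s ≠ 1 by
    obtain ⟨w, hw, h⟩ := this
    obtain ⟨g, hg⟩ := hG w hw
    exact ⟨g, h g hg⟩
  induction S, hS using Set.Finite.induction_on with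
  | empty => exact ⟨wordVar G, wordVar_ne_one, by simp⟩
  | @insert a S _ _ ih =>
    obtain ⟨w, hw, h⟩ := ih fun s hs => h1 s (mem_insert_of_mem _ hs)
    obtain ⟨s, t, hst⟩ := Coprod.exists_conj_commutator_ne_one
      FreeGroup.exists_ne_one_mul_ne_one (h1 a (mem_insert _ _)) hw
    refine ⟨_, hst, fun g hg => ?_⟩
    simp only [map_commutatorElement, map_mul, map_inv] at hg
    rw [forall_mem_insert]
    exact ⟨fun ha => hg (by simp [ha]), h g fun hw' => hg (by simp [hw'])⟩

/-- The letter of the alphabet `Bool × G` as a word with constants: `(true, f)` stands for `f` and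
`(false, f)` for the conjugate of `f` by the variable. -/
def letterWord (a : Bool × G) : Coprod G (FreeGroup Unit) :=
  if a.1 then Coprod.inl a.2 else wordVar G * Coprod.inl a.2 * (wordVar G)⁻¹

theorem letterWord_inv (a : Bool × G) : letterWord (a.1, a.2⁻¹) = (letterWord a)⁻¹ := by
  unfold letterWord
  split_ifs <;> simp [mul_assoc]

/-- The action of words with constants on two copies of `G`: constants act on the first copy by
left multiplication, and the variable swaps the copies. -/
def wordAction (G : Type) [Group G] : Coprod G (FreeGroup Unit) →* Equiv.Perm (Bool × G) :=
  Coprod.lift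
    { toFun := fun a =>
        { toFun := fun p => (p.1, if p.1 then a * p.2 else p.2)
          invFun := fun p => (p.1, if p.1 then a⁻¹ * p.2 else p.2)
          left_inv := by rintro ⟨_ | _, h⟩ <;> simp
          right_inv := by rintro ⟨_ | _, h⟩ <;> simp }
      map_one' := by ext ⟨_ | _, h⟩ <;> simp
      map_mul' := fun a b => by ext ⟨_ | _, h⟩ <;> simp [mul_assoc] }
    (FreeGroup.lift fun _ => Equiv.prodCongr Equiv.boolNot (Equiv.refl G))

theorem wordAction_letterWord (a p : Bool × G) :
    wordAction G (letterWord a) p = (p.1, if a.1 = p.1 then a.2 * p.2 else p.2) := by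
  have hinv : (Equiv.prodCongr Equiv.boolNot (Equiv.refl G))⁻¹
      = Equiv.prodCongr Equiv.boolNot (Equiv.refl G) := by
    ext ⟨_ | _, h⟩ <;> rfl
  obtain ⟨_ | _, f⟩ := a <;> obtain ⟨_ | _, h⟩ := p <;>
    simp [letterWord, wordAction, hinv]

/-- The length of a letter is a lower bound for the weight of any word which represents it. -/
theorem length_le_of_letterWord_eq {L : Bool → G → ℕ} (hL : ∀ b, IsLengthFun (L b))
    {w : List (Bool × G)} {a : Bool × G} (h : (w.map letterWord).prod = letterWord a) :
    L a.1 a.2 ≤ (w.map fun p => L p.1 p.2).sum := by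
  have key : ∀ w : List (Bool × G), ∃ f : G,
      wordAction G (w.map letterWord).prod (a.1, 1) = (a.1, f) ∧
        L a.1 f ≤ (w.map fun p => L p.1 p.2).sum := by
    intro w
    induction w with
    | nil => exact ⟨1, by simp, by simp [((hL a.1).1 1).2 rfl]⟩
    | cons p w ih =>
      obtain ⟨f, hf, hle⟩ := ih
      refine ⟨if p.1 = a.1 then p.2 * f else f, ?_, ?_⟩
      · rw [List.map_cons, List.prod_cons, map_mul, Equiv.Perm.mul_apply, hf,
          wordAction_letterWord]
      · rw [List.map_cons, List.sum_cons]
        split_ifs with hp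
        · have := (hL a.1).2.2 p.2 f
          rw [hp]
          omega
        · omega
  obtain ⟨f, hf, hle⟩ := key w
  rw [h, wordAction_letterWord] at hf
  simp only [if_true, mul_one, Prod.mk.injEq, true_and] at hf
  rwa [hf]

end MIF

section CappedLength

variable {G A : Type*} [Group G]

/-- The least weight of a word over a weighted alphabet which represents a given element of `G`,
capped at `N`. -/
noncomputable def cappedLength (v : A → G) (c : A → ℕ) (N : ℕ) (h : G) : ℕ :=
  sInf {n | n = N ∨ ∃ w : List A, (w.map v).prod = h ∧ (w.map c).sum = n}

variable (v : A → G) (c : A → ℕ) (N : ℕ)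

theorem cappedLength_le_cap (h : G) : cappedLength v c N h ≤ N := Nat.sInf_le (Or.inl rfl)

theorem cappedLength_le_sum (w : List A) :
    cappedLength v c N (w.map v).prod ≤ (w.map c).sum :=
  Nat.sInf_le (Or.inr ⟨w, rfl, rfl⟩)

theorem cappedLength_spec (h : G) : cappedLength v c N h = N ∨
    ∃ w : List A, (w.map v).prod = h ∧ (w.map c).sum = cappedLength v c N h :=
  Nat.sInf_mem (s := {n | n = N ∨ ∃ w : List A, (w.map v).prod = h ∧ (w.map c).sum = n})
    ⟨N, Or.inl rfl⟩

variable {v c N}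

theorem isLengthFun_cappedLength (hN : 0 < N) (hc : ∀ a, 0 < c a)
    (hinv : ∀ a, ∃ b, v b = (v a)⁻¹ ∧ c b = c a) : IsLengthFun (cappedLength v c N) := by
  have hle : ∀ g : G, cappedLength v c N g⁻¹ ≤ cappedLength v c N g := by
    intro g
    rcases cappedLength_spec v c N g with h | ⟨w, hw, hs⟩
    · exact (cappedLength_le_cap v c N _).trans h.ge
    · choose i hiv hic using hinv
      have := cappedLength_le_sum v c N (w.reverse.map i)
      have hprod : ((w.reverse.map i).map v).prod = g⁻¹ := by
        rw [← hw, List.prod_inv_reverse, List.map_map, List.map_reverse, List.map_map]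
        congr 3
        funext a
        exact hiv a
      have hsum : ((w.reverse.map i).map c).sum = (w.map c).sum := by
        rw [List.map_map, List.map_reverse, List.sum_reverse]
        congr 2
        funext a
        exact hic a
      rwa [hprod, hsum, hs] at this
  refine ⟨fun g => ⟨fun h0 => ?_, ?_⟩, fun g => le_antisymm (hle g) ?_, fun g h => ?_⟩
  · rcases cappedLength_spec v c N g with h | ⟨_ | ⟨a, w⟩, hw, hs⟩
    · omega
    · simpa using hw.symm
    · have := hc a
      simp only [List.map_cons, List.sum_cons] at hs
      omega
  · rintro rfl
    simpa using cappedLength_le_sum v c N []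
  · simpa using hle g⁻¹
  · rcases cappedLength_spec v c N g with hg | ⟨w, hw, hs⟩
    · have := cappedLength_le_cap v c N (g * h)
      omega
    rcases cappedLength_spec v c N h with hh | ⟨w', hw', hs'⟩
    · have := cappedLength_le_cap v c N (g * h)
      omega
    simpa [hw, hw', hs, hs'] using cappedLength_le_sum v c N (w ++ w')

end CappedLength

/-- On an MIF group one length function can be prescribed on a finite set while another one is
prescribed on a conjugate of that set. -/
theorem MIF.exists_lengthFun {G : Type} [Group G] (hG : MIF G) {ℓ₁ ℓ₂ : G → ℕ}
    (h₁ : IsLengthFun ℓ₁) (h₂ : IsLengthFun ℓ₂) {I : Set G} (hI : I.Finite) :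
    ∃ (g : G) (ℓ : G → ℕ), IsLengthFun ℓ ∧
      ∀ f ∈ I, ℓ (g * f * g⁻¹) = ℓ₁ f ∧ ℓ f = ℓ₂ f := by
  let L : Bool → G → ℕ := fun b => if b then ℓ₂ else ℓ₁
  have hL : ∀ b, IsLengthFun (L b) := by rintro (_ | _) <;> assumption
  let K : Set (Bool × G) := {a | a.2 ≠ 1 ∧ a.2 ∈ I ∪ I⁻¹}
  have hK : K.Finite := (finite_univ.prod (hI.union hI.inv)).subset fun a ha => ⟨trivial, ha.2⟩
  have : Finite K := hK
  have := Fintype.ofFinite K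
  let u : K → Coprod G (FreeGroup Unit) := fun a => letterWord a.1
  let c : K → ℕ := fun a => L a.1.1 a.1.2
  have hc : ∀ a, 0 < c a := fun a => Nat.pos_of_ne_zero fun h => a.2.1 (((hL _).1 _).1 h)
  let N := 1 + ∑ a, c a
  have hcN : ∀ a, c a ≤ N := fun a =>
    (Finset.single_le_sum (fun _ _ => Nat.zero_le _) (Finset.mem_univ a)).trans (by omega)
  let S : Set (Coprod G (FreeGroup Unit)) :=
    (fun p : List K × K => (p.1.map u).prod * (u p.2)⁻¹) ''
      ({w | w.length ≤ N} ×ˢ univ) \ {1}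
  have hS : S.Finite := (((List.finite_length_le K N).prod finite_univ).image _).sdiff
  obtain ⟨g, hg⟩ := hG.exists_forall_evalAt_ne_one hS fun s hs => hs.2
  let v : K → G := fun a => evalAt g (u a)
  have hlen : IsLengthFun (cappedLength v c N) := by
    refine isLengthFun_cappedLength (by omega) hc fun a => ?_
    refine ⟨⟨(a.1.1, a.1.2⁻¹), inv_ne_one.2 a.2.1, ?_⟩, ?_, (hL _).2.1 _⟩
    · have := a.2.2
      simp only [mem_union, mem_inv, inv_inv] at this ⊢
      exact this.symm
    · simp only [v, u, letterWord_inv, map_inv]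
  have hval : ∀ a, cappedLength v c N (v a) = c a := by
    intro a
    apply le_antisymm
    · simpa using cappedLength_le_sum v c N [a]
    rcases cappedLength_spec v c N (v a) with h | ⟨w, hw, hs⟩
    · exact (hcN a).trans h.ge
    rw [← hs]
    by_contra! hlt
    have hlength : w.length ≤ (w.map c).sum := by
      simpa only [List.length_map] using List.length_le_sum_of_one_le (w.map c)
        (List.forall_mem_map.2 fun a _ => hc a)
    have heq : (w.map u).prod = u a := by
      by_contra hne
      refine hg ((w.map u).prod * (u a)⁻¹)
        ⟨⟨(w, a), ⟨hlength.trans (hlt.le.trans (hcN a)), trivial⟩, rfl⟩,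
          fun h => hne (mul_inv_eq_one.1 h)⟩ ?_
      rw [map_mul, map_inv, mul_inv_eq_one, map_list_prod, List.map_map]
      exact hw
    have := length_le_of_letterWord_eq hL (w := w.map Subtype.val) (a := a.1)
      (by rw [List.map_map]; exact heq)
    rw [List.map_map] at this
    exact hlt.not_ge this
  refine ⟨g, _, hlen, fun f hf => ?_⟩
  by_cases hf1 : f = 1
  · subst hf1
    simp [(hlen.1 1).2, (h₁.1 1).2, (h₂.1 1).2]
  · have key : ∀ b, cappedLength v c N (evalAt g (letterWord (b, f))) = L b f := fun b =>
      hval ⟨(b, f), hf1, Or.inl hf⟩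
    exact ⟨by simpa [letterWord, L] using key false, by simpa [letterWord, L] using key true⟩

/-- An open set of length functions contains all length functions which agree with a given
member on a suitable finite set. -/
theorem exists_finite_forall_eqOn_mem {G : Type*} [Group G] {U : Set (LengthFun G)}
    (hU : IsOpen U) {ℓ : LengthFun G} (hℓ : ℓ ∈ U) :
    ∃ I : Set G, I.Finite ∧ ∀ ℓ' : LengthFun G, EqOn ℓ'.1 ℓ.1 I → ℓ' ∈ U := by
  obtain ⟨W, hW, rfl⟩ := isOpen_induced_iff.1 hU
  obtain ⟨I, u, hu, hIW⟩ := isOpen_pi_iff.1 hW ℓ.1 hℓ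
  refine ⟨I, I.finite_toSet, fun ℓ' h => hIW fun a ha => ?_⟩
  rw [h ha]
  exact (hu a ha).2

theorem stmt5 (G : Type) [Group G] [Countable G] (hG : MIF G) :
    ConjTopTransitive G := by
  rintro U V hU hV ⟨ℓ₁, h₁⟩ ⟨ℓ₂, h₂⟩
  obtain ⟨I, hI, hIU⟩ := exists_finite_forall_eqOn_mem hU h₁
  obtain ⟨J, hJ, hJV⟩ := exists_finite_forall_eqOn_mem hV h₂
  obtain ⟨g, ℓ, hℓ, h⟩ := hG.exists_lengthFun ℓ₁.2 ℓ₂.2 (hI.union hJ)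
  refine ⟨g, ⟨ℓ, hℓ⟩, ⟨conjLF g⁻¹ ⟨ℓ, hℓ⟩, hIU _ fun f hf => ?_, ?_⟩,
    hJV _ fun f hf => (h f (Or.inr hf)).2⟩
  · simpa [conjLF] using (h f (Or.inl hf)).1
  · ext x
    simp [conjLF, mul_assoc]
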